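/- For every nonnegative integer n, Σ_{k=−n}^{n} (−1)^k · C(2n, n+k)^5 = C(2n, n) · Σ_{k=0}^{n} C(3n−k, n−k) · C(2n+k, k) · C(2n, n+k)², and this also equals C(2n, n) · Σ_{k=0}^{n} C(3n−k, n−k) · C(2n+k, k) · C(2n, k)². In particular, the alternating sum Σ_{k=−n}^{n} (−1)^k C(2n, n+k)^5 is divisible by the central binomial coefficient C(2n, n). -/

import Mathlib

/-- The binomial coefficient `C(a, b)` with an integer lower index,
equal to `0` when `b < 0` (and, via `Nat.choose`, also when `b > a`). -/
def intChoose (a : ℕ) (b : ℤ) : ℕ := if 0 ≤ b then a.choose b.toNat else 0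

/-- The reciprocal factorial `1 / z!` on the integers, equal to `0` when `z < 0`. -/
def invFactorial (z : ℤ) : ℚ := if 0 ≤ z then ((z.toNat.factorial : ℕ) : ℚ)⁻¹ else 0

lemma invFactorial_of_neg {z : ℤ} (hz : z < 0) : invFactorial z = 0 := by
  simp [invFactorial, not_le.2 hz]

lemma invFactorial_natCast (m : ℕ) : invFactorial m = ((m.factorial : ℕ) : ℚ)⁻¹ := by
  simp [invFactorial]

lemma factorial_toNat_mul_invFactorial {z : ℤ} (hz : 0 ≤ z) :
    (z.toNat.factorial : ℚ) * invFactorial z = 1 := by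
  rw [invFactorial, if_pos hz]
  exact mul_inv_cancel₀ (by exact_mod_cast Nat.factorial_ne_zero _)

lemma invFactorial_sub_mul_invFactorial (m j : ℕ) :
    invFactorial (m - j) * invFactorial j = m.choose j * invFactorial m := by
  rcases le_or_gt j m with h | h
  · rw [← Nat.cast_sub h]
    simp only [invFactorial_natCast]
    rw [Nat.cast_choose ℚ h]
    have := Nat.factorial_ne_zero m
    field_simp
  · rw [Nat.choose_eq_zero_of_lt h, invFactorial_of_neg (by omega)]
    simp

lemma choose_eq_factorial_mul_invFactorial (m j : ℕ) :
    (m.choose j : ℚ) = m.factorial * (invFactorial (m - j) * invFactorial j) := by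
  rw [invFactorial_sub_mul_invFactorial, invFactorial_natCast]
  have := Nat.factorial_ne_zero m
  field_simp

lemma sum_range_invFactorial (p q r : ℕ) :
    ∑ j ∈ Finset.range (q + 1), invFactorial (p - j) * invFactorial (q - j) *
        (invFactorial j * invFactorial (j + (r - q))) =
      (p + r).factorial * (invFactorial p * invFactorial (p + r - q) *
        (invFactorial q * invFactorial r)) := by
  have key := congrArg (Nat.cast (R := ℚ)) (Nat.add_choose_eq p r q)
  rw [Finset.Nat.sum_antidiagonal_eq_sum_range_succ (fun i j => p.choose i * r.choose j)] at key
  have h := choose_eq_factorial_mul_invFactorial (p + r) q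
  push_cast at key h
  calc _ = ∑ j ∈ Finset.range (q + 1), (p.choose j * r.choose (q - j) : ℚ) *
          (invFactorial p * invFactorial r) := by
        refine Finset.sum_congr rfl fun j hj => ?_
        have hj : j ≤ q := by simpa [Nat.lt_succ_iff] using hj
        have h1 := invFactorial_sub_mul_invFactorial p j
        have h2 := invFactorial_sub_mul_invFactorial r (q - j)
        rw [Nat.cast_sub hj, show (r : ℤ) - (q - j) = j + (r - q) by ring] at h2
        linear_combination h1 * (invFactorial (j + (r - q)) * invFactorial (q - j)) +
          p.choose j * invFactorial p * h2
    _ = _ := by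
        rw [← Finset.sum_mul, ← key, h]
        ring

/-- The Chu–Vandermonde identity in symmetric form. -/
lemma sum_invFactorial (S : Finset ℤ) (a b c d : ℤ)
    (hS : ∀ t, -c ≤ t → -d ≤ t → t ≤ a → t ≤ b → t ∈ S) :
    ∑ t ∈ S, invFactorial (a - t) * invFactorial (b - t) *
        (invFactorial (t + c) * invFactorial (t + d)) =
      (a + b + c + d).toNat.factorial * (invFactorial (a + c) * invFactorial (a + d) *
        (invFactorial (b + c) * invFactorial (b + d))) := by
  by_cases h : 0 ≤ a + c ∧ 0 ≤ b + c ∧ 0 ≤ b + d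
  · obtain ⟨hp, hq, hr⟩ := h
    obtain ⟨p, hp⟩ := Int.eq_ofNat_of_zero_le hp
    obtain ⟨q, hq⟩ := Int.eq_ofNat_of_zero_le hq
    obtain ⟨r, hr⟩ := Int.eq_ofNat_of_zero_le hr
    have key := sum_range_invFactorial p q r
    rw [show (a + b + c + d).toNat = p + r by omega, show a + d = p + r - q by omega, hp, hq, hr,
      ← key]
    symm
    refine Finset.sum_bij_ne_zero (fun j _ _ => (j : ℤ) - c) ?_ ?_ ?_ ?_
    · intro j _ hj
      apply hS
      · omega
      · by_contra hlt
        exact hj (by rw [invFactorial_of_neg (z := j + (r - q)) (by omega)]; ring)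
      · by_contra hlt
        exact hj (by rw [invFactorial_of_neg (z := p - j) (by omega)]; ring)
      · by_contra hlt
        exact hj (by rw [invFactorial_of_neg (z := q - j) (by omega)]; ring)
    · intro i _ _ j _ _ hij
      omega
    · intro t _ ht
      have h1 : 0 ≤ t + c := by
        by_contra hlt
        exact ht (by rw [invFactorial_of_neg (z := t + c) (by omega)]; ring)
      have h2 : 0 ≤ b - t := by
        by_contra hlt
        exact ht (by rw [invFactorial_of_neg (z := b - t) (by omega)]; ring)
      have h3 : ((t + c).toNat : ℤ) = t + c := Int.toNat_of_nonneg h1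
      refine ⟨(t + c).toNat, Finset.mem_range.2 (by omega), ?_, by omega⟩
      rwa [h3, show (p : ℤ) - (t + c) = a - t by omega, show (q : ℤ) - (t + c) = b - t by omega,
        show t + c + ((r : ℤ) - q) = t + d by omega]
    · intro j _ _
      congr 3 <;> omega
  · rw [Finset.sum_eq_zero]
    · have : a + c < 0 ∨ b + c < 0 ∨ b + d < 0 := by omega
      rcases this with h | h | h <;> simp [invFactorial_of_neg h]
    · intro t _
      have : a - t < 0 ∨ b - t < 0 ∨ t + c < 0 ∨ t + d < 0 := by omega
      rcases this with h | h | h | h <;> simp [invFactorial_of_neg h]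

lemma invFactorial_mul_expand (N k a b : ℤ) (ha : 0 ≤ a) (hb : 0 ≤ b) (hN : a ≤ N) :
    invFactorial (a - k) * invFactorial (a + k) * (invFactorial (b - k) * invFactorial (b + k)) =
      ∑ t ∈ Finset.Icc 0 N, invFactorial (a + b) * (invFactorial (a - t) * invFactorial (b - t)) *
        (invFactorial (t - k) * invFactorial (t + k)) := by
  have h := sum_invFactorial (Finset.Icc 0 N) a b (-k) k
    (fun t _ _ _ _ => Finset.mem_Icc.2 ⟨by omega, by omega⟩)
  rw [show a + b + -k + k = a + b by ring] at h
  simp only [← sub_eq_add_neg] at h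
  have h1 := factorial_toNat_mul_invFactorial (z := a + b) (by omega)
  simp only [mul_assoc (invFactorial (a + b))]
  rw [← Finset.mul_sum, h]
  linear_combination -(invFactorial (a - k) * invFactorial (a + k) *
    (invFactorial (b - k) * invFactorial (b + k))) * h1

lemma negOnePow_natCast_sub (j u : ℕ) :
    (((j : ℤ) - u).negOnePow : ℤ) = (-1) ^ u * (-1) ^ j := by
  rw [Int.negOnePow_sub, Units.val_mul, Int.negOnePow_def, Int.negOnePow_def]
  simp [mul_comm]

lemma alternating_sum_invFactorial (N u : ℤ) (hu : 0 ≤ u) (hN : u ≤ N) :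
    ∑ k ∈ Finset.Icc (-N) N, ((k.negOnePow : ℤ) : ℚ) *
      (invFactorial (u - k) * invFactorial (u + k)) = if u = 0 then 1 else 0 := by
  obtain ⟨u, rfl⟩ := Int.eq_ofNat_of_zero_le hu
  have key := congrArg (Int.cast (R := ℚ)) (Int.alternating_sum_range_choose (n := 2 * u))
  push_cast at key
  have : ∑ k ∈ Finset.Icc (-N) N, ((k.negOnePow : ℤ) : ℚ) *
      (invFactorial (u - k) * invFactorial (u + k)) =
      ∑ j ∈ Finset.range (2 * u + 1), (-1) ^ u * invFactorial ((2 * u : ℕ)) *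
        ((-1) ^ j * ((2 * u).choose j : ℚ)) := by
    symm
    refine Finset.sum_bij_ne_zero (fun j _ _ => (j : ℤ) - u) ?_ ?_ ?_ ?_
    · intro j hj _
      have := Finset.mem_range.1 hj
      exact Finset.mem_Icc.2 ⟨by omega, by omega⟩
    · intro i _ _ j _ _ hij
      omega
    · intro k _ hk
      have h1 : 0 ≤ (u : ℤ) + k := by
        by_contra hlt
        exact hk (by rw [invFactorial_of_neg (z := u + k) (by omega)]; ring)
      have h2 : 0 ≤ (u : ℤ) - k := by
        by_contra hlt
        exact hk (by rw [invFactorial_of_neg (z := u - k) (by omega)]; ring)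
      refine ⟨(u + k).toNat, Finset.mem_range.2 (by omega), ?_, by omega⟩
      have h3 := Nat.choose_pos (n := 2 * u) (k := (u + k).toNat) (by omega)
      have h4 := Nat.factorial_ne_zero (2 * u)
      rw [invFactorial_natCast]
      positivity
    · intro j _ _
      have h := invFactorial_sub_mul_invFactorial (2 * u) j
      rw [negOnePow_natCast_sub, show (u : ℤ) - (j - u) = (2 * u : ℕ) - j by push_cast; ring,
        show (u : ℤ) + (j - u) = j by ring, h]
      push_cast
      ring
  rw [this, ← Finset.mul_sum, key]
  by_cases h : u = 0
  · subst h; simp [invFactorial]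
  · simp [h]

lemma alternating_sum_invFactorial_two (N a b : ℤ) (ha : 0 ≤ a) (hb : 0 ≤ b) (hN : a ≤ N) :
    ∑ k ∈ Finset.Icc (-N) N, ((k.negOnePow : ℤ) : ℚ) *
      (invFactorial (a - k) * invFactorial (a + k) * (invFactorial (b - k) * invFactorial (b + k)))
      = invFactorial (a + b) * (invFactorial a * invFactorial b) := by
  simp_rw [invFactorial_mul_expand N _ a b ha hb hN, Finset.mul_sum]
  rw [Finset.sum_comm]
  calc _ = ∑ u ∈ Finset.Icc 0 N, invFactorial (a + b) *
        (invFactorial (a - u) * invFactorial (b - u)) * if u = 0 then 1 else 0 := by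
        refine Finset.sum_congr rfl fun u hu => ?_
        obtain ⟨h0, h1⟩ := Finset.mem_Icc.1 hu
        rw [← alternating_sum_invFactorial N u h0 h1, Finset.mul_sum]
        exact Finset.sum_congr rfl fun k _ => by ring
    _ = _ := by
        have : 0 ≤ N := by omega
        simp [this]

/-- Dixon's identity. -/
lemma alternating_sum_invFactorial_three (N a b c : ℤ) (ha : 0 ≤ a) (hb : 0 ≤ b) (hc : 0 ≤ c)
    (hN : a ≤ N) :
    ∑ k ∈ Finset.Icc (-N) N, ((k.negOnePow : ℤ) : ℚ) *
      (invFactorial (a - k) * invFactorial (a + k) * (invFactorial (b - k) * invFactorial (b + k)) *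
        (invFactorial (c - k) * invFactorial (c + k))) =
      (a + b + c).toNat.factorial * (invFactorial a * invFactorial b * invFactorial c *
        (invFactorial (a + b) * invFactorial (b + c) * invFactorial (a + c))) := by
  simp_rw [invFactorial_mul_expand N _ a b ha hb hN, Finset.sum_mul, Finset.mul_sum]
  rw [Finset.sum_comm]
  have h := sum_invFactorial (Finset.Icc 0 N) a b c 0
    (fun t _ _ _ _ => Finset.mem_Icc.2 ⟨by omega, by omega⟩)
  simp only [add_zero] at h
  calc _ = ∑ t ∈ Finset.Icc 0 N, invFactorial (a + b) * invFactorial c *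
        (invFactorial (a - t) * invFactorial (b - t) *
          (invFactorial (t + c) * invFactorial t)) := by
        refine Finset.sum_congr rfl fun t ht => ?_
        obtain ⟨h0, h1⟩ := Finset.mem_Icc.1 ht
        have h2 := alternating_sum_invFactorial_two N t c h0 hc h1
        trans invFactorial (a + b) * (invFactorial (a - t) * invFactorial (b - t)) *
          (invFactorial (t + c) * (invFactorial t * invFactorial c))
        · rw [← h2, Finset.mul_sum]
          exact Finset.sum_congr rfl fun k _ => by ring
        · ring
    _ = _ := by
        rw [← Finset.mul_sum, h]
        ring

lemma invFactorial_cube_expand (n k : ℤ) (hn : 0 ≤ n) :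
    (invFactorial (n - k) * invFactorial (n + k)) ^ 3 =
      ∑ t ∈ Finset.Icc 0 n, invFactorial (2 * n) ^ 3 * (3 * n - t).toNat.factorial *
        invFactorial (n - t) ^ 3 * (invFactorial (t - k) * invFactorial (t + k)) := by
  have h1 := invFactorial_mul_expand n k n n hn hn le_rfl
  calc _ = invFactorial (n - k) * invFactorial (n + k) *
        (invFactorial (n - k) * invFactorial (n + k)) *
        (invFactorial (n - k) * invFactorial (n + k)) := by ring
    _ = ∑ s ∈ Finset.Icc 0 n, ∑ t ∈ Finset.Icc 0 n, invFactorial (n + n) * invFactorial (n - t) *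
        (invFactorial (t - k) * invFactorial (t + k)) *
        (invFactorial (n - s) * invFactorial (n - s) *
          (invFactorial (s + n) * invFactorial (s + -t))) := by
        rw [h1, Finset.sum_mul]
        refine Finset.sum_congr rfl fun s hs => ?_
        have h2 := invFactorial_mul_expand n k n s hn (Finset.mem_Icc.1 hs).1 le_rfl
        trans invFactorial (n + n) * (invFactorial (n - s) * invFactorial (n - s)) *
          (invFactorial (n - k) * invFactorial (n + k) *
            (invFactorial (s - k) * invFactorial (s + k)))
        · ring
        · rw [h2, Finset.mul_sum]
          refine Finset.sum_congr rfl fun t _ => ?_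
          rw [add_comm s n, ← sub_eq_add_neg]
          ring
    _ = _ := by
        rw [Finset.sum_comm]
        refine Finset.sum_congr rfl fun t ht => ?_
        have h0 := (Finset.mem_Icc.1 ht).1
        rw [← Finset.mul_sum, sum_invFactorial (Finset.Icc 0 n) n n n (-t)
          (fun s _ _ _ _ => Finset.mem_Icc.2 ⟨by omega, by omega⟩),
          show n + n + n + -t = 3 * n - t by ring, ← sub_eq_add_neg, ← two_mul]
        ring

lemma alternating_sum_invFactorial_pow_five (n : ℤ) (hn : 0 ≤ n) :
    ∑ k ∈ Finset.Icc (-n) n, ((k.negOnePow : ℤ) : ℚ) *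
      (invFactorial (n - k) * invFactorial (n + k)) ^ 5 =
      ∑ t ∈ Finset.Icc 0 n, invFactorial (2 * n) ^ 4 * (3 * n - t).toNat.factorial *
        (2 * n + t).toNat.factorial * invFactorial (n - t) ^ 3 * invFactorial n ^ 2 *
        invFactorial t * invFactorial (n + t) ^ 2 := by
  have h5 (k : ℤ) : (invFactorial (n - k) * invFactorial (n + k)) ^ 5 =
      (invFactorial (n - k) * invFactorial (n + k)) ^ 2 *
      (invFactorial (n - k) * invFactorial (n + k)) ^ 3 := by ring
  simp_rw [h5, invFactorial_cube_expand n _ hn, Finset.mul_sum]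
  rw [Finset.sum_comm]
  refine Finset.sum_congr rfl fun t ht => ?_
  have h := alternating_sum_invFactorial_three n n n t hn hn (Finset.mem_Icc.1 ht).1 le_rfl
  rw [← two_mul] at h
  trans invFactorial (2 * n) ^ 3 * (3 * n - t).toNat.factorial * invFactorial (n - t) ^ 3 *
    ((2 * n + t).toNat.factorial * (invFactorial n * invFactorial n * invFactorial t *
        (invFactorial (2 * n) * invFactorial (n + t) * invFactorial (n + t))))
  · rw [← h, Finset.mul_sum]
    exact Finset.sum_congr rfl fun k _ => by ring
  · ring

lemma sum_Icc_zero_natCast (n : ℕ) (f : ℤ → ℚ) :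
    ∑ t ∈ Finset.Icc 0 (n : ℤ), f t = ∑ t ∈ Finset.range (n + 1), f t := by
  symm
  refine Finset.sum_bij (fun t _ => (t : ℤ)) ?_ ?_ ?_ ?_
  · intro t ht
    have := Finset.mem_range.1 ht
    exact Finset.mem_Icc.2 ⟨by omega, by omega⟩
  · intro i _ j _ hij
    omega
  · intro t ht
    have := Finset.mem_Icc.1 ht
    exact ⟨t.toNat, Finset.mem_range.2 (by omega), by omega⟩
  · intro t _
    rfl

lemma intChoose_add_eq (n : ℕ) (k : ℤ) (hk : -(n : ℤ) ≤ k) :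
    (intChoose (2 * n) (n + k) : ℚ) =
      (2 * n).factorial * (invFactorial (n - k) * invFactorial (n + k)) := by
  have h0 : 0 ≤ (n : ℤ) + k := by omega
  rw [intChoose, if_pos h0, choose_eq_factorial_mul_invFactorial, Int.toNat_of_nonneg h0,
    show ((2 * n : ℕ) : ℤ) - (n + k) = n - k by push_cast; ring]

theorem alternating_sum_choose_pow_five (n : ℕ) :
    (∑ k ∈ Finset.Icc (-(n : ℤ)) (n : ℤ),
        ((k.negOnePow : ℤ) * (intChoose (2*n) ((n : ℤ) + k))^5)) =
      ((2*n).choose n : ℤ) * ∑ k ∈ Finset.range (n + 1),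
        (((3*n - k).choose (n - k) : ℤ) * ((2*n + k).choose k : ℤ) *
          (((2*n).choose (n + k) : ℤ))^2) := by
  have key := alternating_sum_invFactorial_pow_five n (by positivity)
  rw [sum_Icc_zero_natCast] at key
  rw [← Int.cast_inj (α := ℚ)]
  push_cast
  trans ((2 * n).factorial : ℚ) ^ 5 * ∑ k ∈ Finset.Icc (-(n : ℤ)) n, ((k.negOnePow : ℤ) : ℚ) *
      (invFactorial (n - k) * invFactorial (n + k)) ^ 5
  · rw [Finset.mul_sum]
    refine Finset.sum_congr rfl fun k hk => ?_
    rw [intChoose_add_eq n k (Finset.mem_Icc.1 hk).1]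
    ring
  · rw [key, Finset.mul_sum, Finset.mul_sum]
    refine Finset.sum_congr rfl fun t ht => ?_
    have ht : t ≤ n := by simpa [Nat.lt_succ_iff] using ht
    simp only [choose_eq_factorial_mul_invFactorial]
    rw [show (3 * (n : ℤ) - t).toNat = 3 * n - t by omega,
      show (2 * (n : ℤ) + t).toNat = 2 * n + t by omega,
      show ((3 * n - t : ℕ) : ℤ) - (n - t : ℕ) = (2 * n : ℕ) by omega,
      show ((2 * n + t : ℕ) : ℤ) - t = (2 * n : ℕ) by omega,
      show ((2 * n : ℕ) : ℤ) - n = n by omega,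
      show ((2 * n : ℕ) : ℤ) - (n + t : ℕ) = n - t by omega,
      show 2 * (n : ℤ) = (2 * n : ℕ) by omega,
      show ((n - t : ℕ) : ℤ) = n - t by omega,
      show ((n + t : ℕ) : ℤ) = n + t by omega,
      invFactorial_natCast (2 * n)]
    have := Nat.factorial_ne_zero (2 * n)
    field_simp

theorem sum_choose_reflect (n : ℕ) :
    ∑ k ∈ Finset.range (n + 1),
        (((3*n - k).choose (n - k) : ℤ) * ((2*n + k).choose k : ℤ) *
          (((2*n).choose (n + k) : ℤ))^2) =
      ∑ k ∈ Finset.range (n + 1),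
        (((3*n - k).choose (n - k) : ℤ) * ((2*n + k).choose k : ℤ) *
          (((2*n).choose k : ℤ))^2) := by
  rw [← Finset.sum_range_reflect]
  refine Finset.sum_congr rfl fun k hk => ?_
  have hk : k ≤ n := by simpa [Nat.lt_succ_iff] using hk
  rw [show n + 1 - 1 - k = n - k by omega, show n - (n - k) = k by omega,
    show 3 * n - (n - k) = 2 * n + k by omega, show 2 * n + (n - k) = 3 * n - k by omega,
    ← Nat.choose_symm (n := 2 * n) (k := k) (by omega), show 2 * n - k = n + (n - k) by omega]
  ring

theorem stmt19 (n : ℕ) :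
    ((∑ k ∈ Finset.Icc (-(n : ℤ)) (n : ℤ),
        ((k.negOnePow : ℤ) * (intChoose (2*n) ((n : ℤ) + k))^5)) =
      ((2*n).choose n : ℤ) * ∑ k ∈ Finset.range (n + 1),
        (((3*n - k).choose (n - k) : ℤ) * ((2*n + k).choose k : ℤ) *
          (((2*n).choose (n + k) : ℤ))^2)) ∧
    ((∑ k ∈ Finset.Icc (-(n : ℤ)) (n : ℤ),
        ((k.negOnePow : ℤ) * (intChoose (2*n) ((n : ℤ) + k))^5)) =
      ((2*n).choose n : ℤ) * ∑ k ∈ Finset.range (n + 1),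
        (((3*n - k).choose (n - k) : ℤ) * ((2*n + k).choose k : ℤ) *
          (((2*n).choose k : ℤ))^2)) ∧
    (((2*n).choose n : ℤ) ∣ ∑ k ∈ Finset.Icc (-(n : ℤ)) (n : ℤ),
        ((k.negOnePow : ℤ) * (intChoose (2*n) ((n : ℤ) + k))^5)) := by
  refine ⟨alternating_sum_choose_pow_five n, ?_, ?_⟩
  · rw [alternating_sum_choose_pow_five, sum_choose_reflect]
  · rw [alternating_sum_choose_pow_five]
    exact dvd_mul_right _ _
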